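/- arXiv:1605.04517 — 2 statements merged into one kernel-verified Lean document; each statement's English description precedes it below -/
import Mathlib

section
/- Telescoping sum identity for the odd Gegenbauer coefficients (key identity in the proof of Theorem 5.1/coeffeven): for every natural number n ≥ 2, every natural number N ≥ 1, every λ ∈ ℂ and every i with 0 ≤ i ≤ N, one has (−2N)·(2λ+n−2N−1)·Σ_{j=0}^{N−i} (−1)^{N−j−i} · binom(N−j, i) · ( b_j^{(N−1)}(λ−1) + b_{j−1}^{(N−1)}(λ−1) ) = 2i·α_i^{(N)}(λ), where by convention b_j^{(M)}(μ) := 0 whenever j < 0 or j > M. -/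
open Finset Polynomial

noncomputable def aC (n N j : ℕ) (l : ℂ) : ℂ :=
  (-2 : ℂ) ^ (N - j) *
    ((N.factorial : ℂ) / ((j.factorial : ℂ) * ((2 * N - 2 * j).factorial : ℂ))) *
    ∏ k ∈ Finset.Ico j N, (2 * l - 4 * (N : ℂ) + 2 * (k : ℂ) + (n : ℂ) + 1)

noncomputable def bC (n N j : ℕ) (l : ℂ) : ℂ :=
  (-2 : ℂ) ^ (N - j) *
    ((N.factorial : ℂ) / ((j.factorial : ℂ) * ((2 * N - 2 * j + 1).factorial : ℂ))) *
    ∏ k ∈ Finset.Ico j N, (2 * l - 4 * (N : ℂ) + 2 * (k : ℂ) + (n : ℂ) - 1)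

noncomputable def bCZ (n M : ℕ) (j : ℤ) (l : ℂ) : ℂ :=
  if 0 ≤ j ∧ j ≤ (M : ℤ) then bC n M j.toNat l else 0

noncomputable def alphaC (n N i : ℕ) (l : ℂ) : ℂ :=
  (-1 : ℂ) ^ i * 2 ^ N * ((N.factorial : ℂ) / ((2 * N).factorial : ℂ)) * (N.choose i : ℂ) *
    (∏ k ∈ Finset.Icc (i + 1) N, (2 * l + (n : ℂ) - 2 * (k : ℂ))) *
    ∏ k ∈ Finset.Icc 1 i, (2 * l + (n : ℂ) - 2 * (k : ℂ) - 2 * (N : ℂ) + 1)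

noncomputable def betaC (n N i : ℕ) (l : ℂ) : ℂ :=
  (-1 : ℂ) ^ i * 2 ^ N * ((N.factorial : ℂ) / ((2 * N + 1).factorial : ℂ)) * (N.choose i : ℂ) *
    (∏ k ∈ Finset.Icc (i + 1) N, (2 * l + (n : ℂ) - 2 * (k : ℂ))) *
    ∏ k ∈ Finset.Icc 1 i, (2 * l + (n : ℂ) - 2 * (k : ℂ) - 2 * (N : ℂ) - 1)

noncomputable def gammaC (n N i : ℕ) (l p : ℂ) : ℂ :=
  (-1 : ℂ) ^ i * 2 ^ N *
    ((N.factorial : ℂ) / (((N : ℂ) + 1) * ((2 * N + 1).factorial : ℂ))) *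
    ((N + 1).choose i : ℂ) *
    ((l + p - 2 * (N : ℂ) - 1) * ((N : ℂ) + 1) * (2 * l + (n : ℂ) - 2 * (i : ℂ)) +
      (l + (n : ℂ) - p) * (2 * (N : ℂ) + 1) * ((N : ℂ) - (i : ℂ) + 1)) *
    (∏ k ∈ Finset.Icc (i + 1) N, (2 * l + (n : ℂ) - 2 * (k : ℂ))) *
    ∏ k ∈ Finset.Icc 1 (i - 1), (2 * l + (n : ℂ) - 2 * (k : ℂ) - 2 * (N : ℂ) - 1)

noncomputable def poch (a : ℂ) (l : ℕ) : ℂ :=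
  ∏ m ∈ Finset.range l, (a + (m : ℂ))

noncomputable def cc (m : ℕ) : ℂ := (m.factorial : ℂ) * 2 ^ m / ((2 * m + 1).factorial : ℂ)

lemma cc_succ (m : ℕ) : cc m = (2 * m + 3) * cc (m + 1) := by
  unfold cc
  have h1 : ((2 * m + 1).factorial : ℂ) ≠ 0 := by exact_mod_cast Nat.factorial_ne_zero _
  have h3 : (2 * (m : ℂ) + 3) ≠ 0 := by exact_mod_cast (by omega : 2 * m + 3 ≠ 0)
  have h2 : ((m : ℂ) + 1) ≠ 0 := by exact_mod_cast (by omega : m + 1 ≠ 0)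
  have e : ((2 * (m + 1) + 1).factorial : ℂ)
      = (2 * m + 3) * (2 * (m + 1)) * ((2 * m + 1).factorial : ℂ) := by
    rw [show 2 * (m + 1) + 1 = (2 * m + 1) + 1 + 1 by ring, Nat.factorial_succ,
      Nat.factorial_succ]
    push_cast; ring
  rw [e, Nat.factorial_succ m]
  push_cast
  field_simp
  ring

lemma pascal_sum (P : ℕ) (f : ℕ → ℂ) :
    ∑ s ∈ range (P + 2), ((P + 1).choose s : ℂ) * f s
      = ∑ s ∈ range (P + 1), (P.choose s : ℂ) * f s
        + ∑ s ∈ range (P + 1), (P.choose s : ℂ) * f (s + 1) := by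
  rw [Finset.sum_range_succ']
  have h : ∑ s ∈ range (P + 1), (P.choose s : ℂ) * f s
      = ∑ s ∈ range (P + 1), (P.choose (s + 1) : ℂ) * f (s + 1) + f 0 := by
    have h0 : ∑ s ∈ range (P + 2), (P.choose s : ℂ) * f s
        = ∑ s ∈ range (P + 1), (P.choose s : ℂ) * f s := by
      rw [Finset.sum_range_succ _ (P + 1)]; simp
    rw [← h0, Finset.sum_range_succ']; simp
  rw [h]
  simp only [Nat.choose_succ_succ, Nat.cast_add, add_mul, Finset.sum_add_distrib]
  simp; ring

lemma vander (P : ℕ) : ∀ (i : ℕ) (y : ℂ),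
    ∑ s ∈ range (P + 1), (P.choose s : ℂ) * (cc (i + s) * ∏ t ∈ range s, (y - 2 - 2 * (t : ℂ)))
      = cc (i + P) * ∏ v ∈ range P, (y + 2 * i + 1 + 2 * (v : ℂ)) := by
  induction P with
  | zero => intro i y; simp
  | succ P ih =>
    intro i y
    rw [pascal_sum P (fun s => cc (i + s) * ∏ t ∈ range s, (y - 2 - 2 * (t : ℂ))), ih i y]
    have h : ∑ s ∈ range (P + 1), (P.choose s : ℂ) *
        (cc (i + (s + 1)) * ∏ t ∈ range (s + 1), (y - 2 - 2 * (t : ℂ)))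
        = (y - 2) * ∑ s ∈ range (P + 1), (P.choose s : ℂ) *
        (cc (i + 1 + s) * ∏ t ∈ range s, (y - 2 - 2 - 2 * (t : ℂ))) := by
      rw [Finset.mul_sum]
      refine Finset.sum_congr rfl fun s _ => ?_
      rw [Finset.prod_range_succ', show i + (s + 1) = i + 1 + s by ring]
      have : ∏ k ∈ range s, (y - 2 - 2 * ((k + 1 : ℕ) : ℂ))
          = ∏ t ∈ range s, (y - 2 - 2 - 2 * (t : ℂ)) :=
        Finset.prod_congr rfl fun k _ => by push_cast; ring
      rw [this]; push_cast; ring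
    rw [h, ih (i + 1) (y - 2), Finset.prod_range_succ, cc_succ (i + P),
      show i + 1 + P = i + P + 1 by ring, show i + (P + 1) = i + P + 1 by ring]
    have : ∏ v ∈ range P, (y - 2 + 2 * ((i + 1 : ℕ) : ℂ) + 1 + 2 * (v : ℂ))
        = ∏ v ∈ range P, (y + 2 * i + 1 + 2 * (v : ℂ)) :=
      Finset.prod_congr rfl fun k _ => by push_cast; ring
    rw [this]; push_cast; ring

lemma tele0 (K : ℕ) (e : ℕ → ℂ) :
    ∑ r ∈ range (K + 1), (-1 : ℂ) ^ r * (e r + e (r + 1)) = e 0 + (-1) ^ K * e (K + 1) := by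
  induction K with
  | zero => simp
  | succ K ih => rw [Finset.sum_range_succ, ih]; ring

lemma tele1 (i K : ℕ) (e : ℕ → ℂ) :
    ∑ r ∈ range (K + 1), (-1 : ℂ) ^ r * ((i + 1 + r).choose (i + 1) : ℂ)
        * (e (i + 1 + r) + e (i + 1 + r + 1))
      = ∑ r ∈ range (K + 1), (-1 : ℂ) ^ r * ((i + r).choose i : ℂ) * e (i + 1 + r)
        + (-1) ^ K * ((i + 1 + K).choose (i + 1) : ℂ) * e (i + 1 + K + 1) := by
  induction K with
  | zero => simp
  | succ K ih =>
    rw [Finset.sum_range_succ, ih, Finset.sum_range_succ _ (K + 1)]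
    have h : ((i + 1 + (K + 1)).choose (i + 1) : ℂ)
        = ((i + (K + 1)).choose i : ℂ) + ((i + 1 + K).choose (i + 1) : ℂ) := by
      rw [show i + 1 + (K + 1) = (i + (K + 1)) + 1 by ring, Nat.choose_succ_succ,
        show i + 1 + K = i + (K + 1) by ring]
      push_cast; rfl
    rw [h, show i + 1 + (K + 1) = i + 1 + K + 1 by ring]
    ring

lemma bC_eq (n m q : ℕ) (l : ℂ) :
    bC n (m + q) q l = (-2 : ℂ) ^ m *
      (((m + q).factorial : ℂ) / ((q.factorial : ℂ) * ((2 * m + 1).factorial : ℂ))) *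
      ∏ t ∈ range m, (2 * l + n - 1 - 2 * ((m : ℂ) + q) - 2 - 2 * (t : ℂ)) := by
  unfold bC
  rw [show m + q - q = m by omega, show 2 * (m + q) - 2 * q + 1 = 2 * m + 1 by omega,
    Finset.prod_Ico_eq_prod_range, show m + q - q = m by omega, ← Finset.prod_range_reflect]
  congr 1
  refine Finset.prod_congr rfl fun t ht => ?_
  have : t < m := Finset.mem_range.1 ht
  obtain ⟨u, rfl⟩ := Nat.exists_eq_add_of_lt this
  rw [show t + u + 1 - 1 - t = u by omega]
  push_cast; ring

lemma term_eq (n i s q : ℕ) (l : ℂ) :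
    (-1 : ℂ) ^ s * ((i + s).choose i : ℂ) * bC n (i + s + q) q l
      = ((-1) ^ i * 2 ^ i * ((i + (s + q)).choose i : ℂ) *
          ∏ t ∈ range i, (2 * l + n - 1 - 2 * ((i : ℂ) + s + q) - 2 - 2 * (t : ℂ))) / 2 ^ i *
        (((s + q).choose s : ℂ) * (cc (i + s) *
          ∏ t ∈ range s, (2 * l + n - 1 - 2 * ((i : ℂ) + s + q) - 2 * i - 2 - 2 * (t : ℂ)))) := by
  rw [bC_eq, Finset.prod_range_add, Nat.cast_add_choose, Nat.cast_add_choose,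
    Nat.cast_add_choose, cc]
  have hp : ∏ x ∈ range s, (2 * l + n - 1 - 2 * (((i + s : ℕ) : ℂ) + q) - 2 - 2 * ((i + x : ℕ) : ℂ))
     = ∏ t ∈ range s, (2 * l + n - 1 - 2 * ((i : ℂ) + s + q) - 2 * i - 2 - 2 * (t : ℂ)) :=
    Finset.prod_congr rfl fun k _ => by push_cast; ring
  rw [hp, show ((i + s : ℕ) : ℂ) = (i : ℂ) + s by push_cast; rfl,
    show i + (s + q) = i + s + q by ring]
  have hf : ∀ k : ℕ, (k.factorial : ℂ) ≠ 0 := fun k => by exact_mod_cast Nat.factorial_ne_zero _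
  have := hf i; have := hf s; have := hf q; have := hf (i + s); have := hf (s + q)
  have := hf (2 * (i + s) + 1)
  rw [show (-2 : ℂ) = (-1) * 2 by ring, mul_pow, pow_add (-1 : ℂ) i s]
  have h1 : (-1 : ℂ) ^ s * (-1) ^ s = 1 := by rw [← mul_pow]; simp
  generalize ∏ t ∈ range s, (2 * l + n - 1 - 2 * ((i : ℂ) + s + q) - 2 * i - 2 - 2 * (t : ℂ)) = A
  generalize ∏ t ∈ range i, (2 * l + n - 1 - 2 * ((i : ℂ) + s + q) - 2 - 2 * (t : ℂ)) = B
  generalize (-1 : ℂ) ^ s = z at *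
  generalize (-1 : ℂ) ^ i = w at *
  field_simp
  linear_combination w * ((i + s + q).factorial : ℂ) * B * A * h1

lemma key (n i P : ℕ) (l : ℂ) :
    ∑ s ∈ range (P + 1), (-1 : ℂ) ^ s * ((i + s).choose i : ℂ) * bC n (i + P) (P - s) l
      = (-1) ^ i * ((i + P).choose i : ℂ) *
          (∏ t ∈ range i, (2 * l + n - 1 - 2 * ((i : ℂ) + P) - 2 - 2 * (t : ℂ))) *
        (cc (i + P) * ∏ v ∈ range P, (2 * l + n - 1 - 2 * (P : ℂ) - 2 * i + 1 + 2 * (v : ℂ))) := by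
  have h := vander P i (2 * l + n - 1 - 2 * ((i : ℂ) + P) - 2 * i)
  have e : ∏ v ∈ range P, (2 * l + n - 1 - 2 * ((i : ℂ) + P) - 2 * i + 2 * i + 1 + 2 * (v : ℂ))
    = ∏ v ∈ range P, (2 * l + n - 1 - 2 * (P : ℂ) - 2 * i + 1 + 2 * (v : ℂ)) :=
    Finset.prod_congr rfl fun k _ => by ring
  rw [e] at h
  rw [← h, Finset.mul_sum]
  refine Finset.sum_congr rfl fun s hs => ?_
  obtain ⟨q, rfl⟩ := Nat.exists_eq_add_of_le (Nat.lt_succ_iff.1 (Finset.mem_range.1 hs))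
  have t := term_eq n i s q l
  rw [show s + q - s = q by omega, show i + (s + q) = i + s + q by ring, t,
    show i + (s + q) = i + s + q by ring]
  push_cast
  simp only [← add_assoc]
  field_simp

lemma alpha_eq (n i P : ℕ) (l : ℂ) :
    2 * ((i + 1 : ℕ) : ℂ) * alphaC n (i + 1 + P) (i + 1) l
      = (-(2 * ((i + 1 + P : ℕ) : ℂ))) * (2 * l + (n : ℂ) - 2 * ((i + 1 + P : ℕ) : ℂ) - 1) *
       ((-1) ^ i * ((i + P).choose i : ℂ) *
          (∏ t ∈ range i, (2 * (l - 1) + n - 1 - 2 * ((i : ℂ) + P) - 2 - 2 * (t : ℂ))) *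
        (cc (i + P) * ∏ v ∈ range P,
          (2 * (l - 1) + n - 1 - 2 * (P : ℂ) - 2 * i + 1 + 2 * (v : ℂ)))) := by
  unfold alphaC
  have e1 : ∏ k ∈ Finset.Icc (i + 1 + 1) (i + 1 + P), (2 * l + (n : ℂ) - 2 * (k : ℂ))
      = ∏ v ∈ range P, (2 * (l - 1) + n - 1 - 2 * (P : ℂ) - 2 * i + 1 + 2 * (v : ℂ)) := by
    rw [← Finset.Ico_add_one_right_eq_Icc, Finset.prod_Ico_eq_prod_range,
      show i + 1 + P + 1 - (i + 1 + 1) = P by omega, ← Finset.prod_range_reflect]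
    refine Finset.prod_congr rfl fun t ht => ?_
    obtain ⟨u, rfl⟩ := Nat.exists_eq_add_of_lt (Finset.mem_range.1 ht)
    rw [show t + u + 1 - 1 - t = u by omega]
    push_cast; ring
  have e2 : ∏ k ∈ Finset.Icc 1 (i + 1),
        (2 * l + (n : ℂ) - 2 * (k : ℂ) - 2 * ((i + 1 + P : ℕ) : ℂ) + 1)
      = (∏ t ∈ range i, (2 * (l - 1) + n - 1 - 2 * ((i : ℂ) + P) - 2 - 2 * (t : ℂ)))
        * (2 * l + (n : ℂ) - 2 * ((i + 1 + P : ℕ) : ℂ) - 1) := by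
    rw [← Finset.Ico_add_one_right_eq_Icc, Finset.prod_Ico_eq_prod_range,
      show i + 1 + 1 - 1 = i + 1 by omega, Finset.prod_range_succ']
    congr 1
    · refine Finset.prod_congr rfl fun t ht => ?_
      push_cast; ring
    · push_cast; ring
  have hc : ((i + 1 : ℕ) : ℂ) * ((i + 1 + P).choose (i + 1) : ℂ)
      = ((i + 1 + P : ℕ) : ℂ) * ((i + P).choose i : ℂ) := by
    have := Nat.add_one_mul_choose_eq (i + P) i
    rw [show i + 1 + P = i + P + 1 by ring]
    have h2 : (((i + P + 1) * (i + P).choose i : ℕ) : ℂ)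
      = (((i + P + 1).choose (i + 1) * (i + 1) : ℕ) : ℂ) := by rw [this]
    push_cast at h2 ⊢
    rw [h2]; ring
  have hk : (2 : ℂ) ^ (i + 1 + P) * (((i + 1 + P).factorial : ℂ) / ((2 * (i + 1 + P)).factorial : ℂ))
      = cc (i + P) := by
    unfold cc
    rw [show 2 * (i + 1 + P) = 2 * (i + P) + 1 + 1 by ring, show i + 1 + P = i + P + 1 by ring,
      Nat.factorial_succ, Nat.factorial_succ (2 * (i + P) + 1)]
    have h1 : ((2 * (i + P) + 1).factorial : ℂ) ≠ 0 := by exact_mod_cast Nat.factorial_ne_zero _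
    have h2 : ((i : ℂ) + P + 1) ≠ 0 := by exact_mod_cast (by omega : i + P + 1 ≠ 0)
    push_cast
    rw [show (2 * ((i : ℂ) + P) + 1 + 1) = 2 * ((i : ℂ) + P + 1) by ring]
    field_simp
    ring
  rw [e1, e2, ← hk]
  generalize ∏ v ∈ range P, (2 * (l - 1) + n - 1 - 2 * (P : ℂ) - 2 * i + 1 + 2 * (v : ℂ)) = A
  generalize ∏ t ∈ range i, (2 * (l - 1) + n - 1 - 2 * ((i : ℂ) + P) - 2 - 2 * (t : ℂ)) = B
  generalize (((i + 1 + P).factorial : ℂ) / ((2 * (i + 1 + P)).factorial : ℂ)) = F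
  generalize (2 : ℂ) ^ (i + 1 + P) = T
  generalize (2 * l + (n : ℂ) - 2 * ((i + 1 + P : ℕ) : ℂ) - 1) = X
  rw [pow_succ]
  linear_combination (-2 * (-1 : ℂ) ^ i * T * F * A * B * X) * hc

theorem telescoping_sum_odd_gegenbauer (n : ℕ) (hn : 2 ≤ n) (N : ℕ) (hN : 1 ≤ N) (l : ℂ)
    (i : ℕ) (hi : i ≤ N) :
    (-(2 * (N : ℂ))) * (2 * l + (n : ℂ) - 2 * (N : ℂ) - 1) *
        ∑ j ∈ Finset.range (N - i + 1),
          (-1 : ℂ) ^ (N - j - i) * ((N - j).choose i : ℂ) *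
            (bCZ n (N - 1) (j : ℤ) (l - 1) + bCZ n (N - 1) ((j : ℤ) - 1) (l - 1))
      = 2 * (i : ℂ) * alphaC n N i l := by
  obtain ⟨K, rfl⟩ := Nat.exists_eq_add_of_le hi
  set e : ℕ → ℂ := fun k => bCZ n (i + K - 1) (((i + K : ℕ) : ℤ) - k) (l - 1) with he
  have h0 : e 0 = 0 := by
    simp only [he, bCZ]; rw [if_neg]; push_cast; omega
  have h1 : e (i + K + 1) = 0 := by
    simp only [he, bCZ]; rw [if_neg]; push_cast; omega
  have hs : ∑ j ∈ Finset.range (i + K - i + 1),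
          (-1 : ℂ) ^ (i + K - j - i) * ((i + K - j).choose i : ℂ) *
            (bCZ n (i + K - 1) (j : ℤ) (l - 1) + bCZ n (i + K - 1) ((j : ℤ) - 1) (l - 1))
      = ∑ r ∈ range (K + 1), (-1 : ℂ) ^ r * ((i + r).choose i : ℂ)
        * (e (i + r) + e (i + r + 1)) := by
    rw [show i + K - i = K by omega, ← Finset.sum_range_reflect]
    refine Finset.sum_congr rfl fun r hr => ?_
    have hr' := Finset.mem_range.1 hr
    have a1 : i + K - (K + 1 - 1 - r) = i + r := by omega
    have a2 : ((K + 1 - 1 - r : ℕ) : ℤ) = ((i + K : ℕ) : ℤ) - ((i + r : ℕ) : ℤ) := by omega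
    have a3 : ((i + K : ℕ) : ℤ) - ((i + r : ℕ) : ℤ) - 1
      = ((i + K : ℕ) : ℤ) - ((i + r + 1 : ℕ) : ℤ) := by omega
    rw [a1, a2, a3, show i + r - i = r by omega]
  rw [hs]
  cases i with
  | zero =>
    have := tele0 K e
    simp only [zero_add] at h1
    simp only [zero_add, Nat.choose_zero_right, Nat.cast_one, mul_one, this, h0, h1]
    simp
  | succ i =>
    rw [tele1, h1, mul_zero, add_zero, alpha_eq, ← key]
    congr 1
    refine Finset.sum_congr rfl fun s hs => ?_
    have hs' := Finset.mem_range.1 hs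
    congr 1
    simp only [he, bCZ]
    rw [if_pos (by omega), show i + 1 + K - 1 = i + K by omega]
    congr 1
    omega
end

section
/- Summation formula for the γ-coefficients (identity (help-34) in the proof of Theorem 5.3/coeffodd2): for every natural number n ≥ 2, every natural number N ≥ 1, all λ, p ∈ ℂ and every i with 1 ≤ i ≤ N, one has Σ_{j=−1}^{N−i} (−1)^{N−j−i−1} · binom(N−j, i) · [ (λ+p−2N+1+2j)·b_{j+1}^{(N)}(λ) − (2N−2j+1)·b_j^{(N)}(λ) ] = γ_i^{(N)}(λ;p), where by convention b_j^{(M)}(μ) := 0 whenever j < 0 or j > M. -/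
open Finset Polynomial

/-- Falling product with step two. -/
noncomputable def ff (a : ℂ) (r : ℕ) : ℂ := ∏ t ∈ Finset.range r, (a - 2 * (t : ℂ))

lemma ff_zero (a : ℂ) : ff a 0 = 1 := by simp [ff]

lemma ff_succ (a : ℂ) (r : ℕ) : ff a (r + 1) = ff a r * (a - 2 * (r : ℂ)) := by
  simp [ff, Finset.prod_range_succ]

lemma ff_succ' (a : ℂ) (r : ℕ) : ff a (r + 1) = a * ff (a - 2) r := by
  simp only [ff, Finset.prod_range_succ']
  rw [mul_comm]
  congr 1
  · simp
  · apply Finset.prod_congr rfl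
    intro t _
    push_cast
    ring

lemma ff_add (a : ℂ) (i r : ℕ) : ff a (i + r) = ff a i * ff (a - 2 * (i : ℂ)) r := by
  simp only [ff, Finset.prod_range_add]
  congr 1
  apply Finset.prod_congr rfl
  intro t _
  push_cast
  ring

lemma ff_vandermonde (x y : ℂ) (M : ℕ) :
    ∑ r ∈ Finset.range (M + 1), (M.choose r : ℂ) * (ff x r * ff y (M - r)) = ff (x + y) M := by
  rw [← Finset.Nat.sum_antidiagonal_eq_sum_range_succ
    (fun a b => (M.choose a : ℂ) * (ff x a * ff y b)) M]
  induction M with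
  | zero => simp [ff_zero]
  | succ M ih =>
    rw [Finset.sum_antidiagonal_choose_succ_mul (fun a b => ff x a * ff y b) M, ff_succ, ← ih,
      Finset.sum_mul, ← Finset.sum_add_distrib]
    apply Finset.sum_congr rfl
    rintro ⟨a, b⟩ hab
    have h : a + b = M := by simpa using hab
    have hc : M.choose b = M.choose a := by
      subst h; exact (Nat.choose_symm_add).symm
    simp only [hc, ff_succ]
    rw [← h]
    push_cast
    ring

lemma ff_fact (m d : ℕ) :
    (2 : ℂ) ^ m * (m.factorial : ℂ) * ((2 * (m + d) + 1).factorial : ℂ) =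
      ff (2 * ((m + d : ℕ) : ℂ) + 1) d * 2 ^ (m + d) * ((m + d).factorial : ℂ) *
        ((2 * m + 1).factorial : ℂ) := by
  induction d with
  | zero => simp [ff_zero]
  | succ d ih =>
    have h1 : (2 * (m + (d + 1)) + 1).factorial =
        (2 * (m + d) + 3) * ((2 * (m + d) + 2) * (2 * (m + d) + 1).factorial) := by
      rw [show 2 * (m + (d + 1)) + 1 = (2 * (m + d) + 1) + 1 + 1 by ring, Nat.factorial_succ,
        Nat.factorial_succ]
    have h2 : (m + (d + 1)).factorial = (m + d + 1) * (m + d).factorial := by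
      rw [← add_assoc, Nat.factorial_succ]
    rw [ff_succ', h1, h2, show (2 * ((m + (d + 1) : ℕ) : ℂ) + 1 - 2) = 2 * ((m + d : ℕ) : ℂ) + 1 by
      push_cast; ring, ← add_assoc, pow_succ]
    push_cast at ih ⊢
    linear_combination (2 * ((m : ℂ) + d) + 3) * (2 * ((m : ℂ) + d) + 2) * ih

/-- Reversed odd Gegenbauer coefficient. -/
noncomputable def BB (N : ℕ) (c : ℂ) (m : ℕ) : ℂ :=
  (-2 : ℂ) ^ m * ((N.factorial : ℂ) / (((N - m).factorial : ℂ) * ((2 * m + 1).factorial : ℂ))) *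
    ff (c - 2) m

lemma BB_sum (N : ℕ) (c : ℂ) (i : ℕ) (hi : i ≤ N) :
    ∑ m ∈ Finset.range (N + 1), (-1 : ℂ) ^ m * (m.choose i : ℂ) * BB N c m =
      2 ^ N * ((N.factorial : ℂ) / ((2 * N + 1).factorial : ℂ)) * (N.choose i : ℂ) *
        ff (c + 2 * (N : ℂ) - 1 - 2 * (i : ℂ)) (N - i) * ff (c - 2) i := by
  obtain ⟨M, rfl⟩ := Nat.exists_eq_add_of_le hi
  rw [add_assoc, Finset.sum_range_add, Finset.sum_eq_zero, zero_add, Nat.add_sub_cancel_left,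
    show c + 2 * ((i + M : ℕ) : ℂ) - 1 - 2 * (i : ℂ) =
      (c - 2 - 2 * (i : ℂ)) + (2 * ((i + M : ℕ) : ℂ) + 1) by ring, ← ff_vandermonde,
    Finset.mul_sum, Finset.sum_mul]
  · apply Finset.sum_congr rfl
    intro r hr
    have hr' : r ≤ M := by simpa [Nat.lt_succ_iff] using hr
    obtain ⟨d, rfl⟩ := Nat.exists_eq_add_of_le hr'
    have hf := ff_fact (i + r) d
    rw [BB, ff_add, show i + (r + d) - (i + r) = d by omega, show r + d - r = d by omega]
    rw [add_assoc] at hf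
    have e1 : ((i + r).choose i : ℂ) * ((i.factorial : ℂ) * (r.factorial : ℂ)) =
        ((i + r).factorial : ℂ) := by
      have := Nat.add_choose_mul_factorial_mul_factorial i r
      rw [← Nat.choose_symm_add] at this
      rw [← this]; push_cast; ring
    have e2 : ((i + (r + d)).choose i : ℂ) * ((i.factorial : ℂ) * ((r + d).factorial : ℂ)) =
        ((i + (r + d)).factorial : ℂ) := by
      have := Nat.add_choose_mul_factorial_mul_factorial i (r + d)
      rw [← Nat.choose_symm_add] at this
      rw [← this]; push_cast; ring
    have e3 : ((r + d).choose r : ℂ) * ((r.factorial : ℂ) * (d.factorial : ℂ)) =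
        ((r + d).factorial : ℂ) := by
      have := Nat.add_choose_mul_factorial_mul_factorial r d
      rw [← Nat.choose_symm_add] at this
      rw [← this]; push_cast; ring
    have hs : (-1 : ℂ) ^ (i + r) * (-2) ^ (i + r) = 2 ^ (i + r) := by
      rw [← mul_pow]; norm_num
    have n1 : ((i.factorial : ℕ) : ℂ) ≠ 0 := by exact_mod_cast Nat.factorial_ne_zero _
    have n2 : ((r.factorial : ℕ) : ℂ) ≠ 0 := by exact_mod_cast Nat.factorial_ne_zero _
    have n3 : ((d.factorial : ℕ) : ℂ) ≠ 0 := by exact_mod_cast Nat.factorial_ne_zero _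
    have n4 : (((r + d).factorial : ℕ) : ℂ) ≠ 0 := by exact_mod_cast Nat.factorial_ne_zero _
    have n5 : (((2 * (i + r) + 1).factorial : ℕ) : ℂ) ≠ 0 := by
      exact_mod_cast Nat.factorial_ne_zero _
    have n6 : (((2 * (i + (r + d)) + 1).factorial : ℕ) : ℂ) ≠ 0 := by
      exact_mod_cast Nat.factorial_ne_zero _
    have c1 : ((i + r).choose i : ℂ) =
        ((i + r).factorial : ℂ) / ((i.factorial : ℂ) * (r.factorial : ℂ)) := by
      rw [eq_div_iff (mul_ne_zero n1 n2), e1]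
    have c2 : ((i + (r + d)).choose i : ℂ) =
        ((i + (r + d)).factorial : ℂ) / ((i.factorial : ℂ) * ((r + d).factorial : ℂ)) := by
      rw [eq_div_iff (mul_ne_zero n1 n4), e2]
    have c3 : ((r + d).choose r : ℂ) =
        ((r + d).factorial : ℂ) / ((r.factorial : ℂ) * (d.factorial : ℂ)) := by
      rw [eq_div_iff (mul_ne_zero n2 n3), e3]
    rw [c1, c2, c3]
    generalize ff (2 * ((i + (r + d) : ℕ) : ℂ) + 1) d = F at *
    generalize ff (c - 2) i = G
    generalize ff (c - 2 - 2 * (i : ℂ)) r = H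
    generalize ((i + (r + d)).factorial : ℂ) = A at *
    generalize ((i + r).factorial : ℂ) = A' at *
    generalize ((2 * (i + r) + 1).factorial : ℂ) = A5 at *
    generalize ((2 * (i + (r + d)) + 1).factorial : ℂ) = A6 at *
    generalize (i.factorial : ℂ) = A1 at *
    generalize (r.factorial : ℂ) = A2 at *
    generalize (d.factorial : ℂ) = A3 at *
    generalize ((r + d).factorial : ℂ) = A4 at *
    generalize (2 : ℂ) ^ (i + (r + d)) = T at *
    trans ((-1 : ℂ) ^ (i + r) * (-2) ^ (i + r)) * (A' / (A1 * A2)) * (A / (A3 * A5)) * (G * H)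
    · ring
    rw [hs]
    generalize (2 : ℂ) ^ (i + r) = U at *
    have hf' : U * A' / A5 = F * T * A / A6 := by
      rw [div_eq_div_iff n5 n6, hf]
    trans (U * A' / A5) * (A / (A1 * A2 * A3)) * (G * H)
    · field_simp
    rw [hf']
    field_simp
  · intro m hm
    rw [Nat.choose_eq_zero_of_lt (by simpa using hm)]
    simp

lemma bCZ_eq (n N m : ℕ) (hm : m ≤ N) (l : ℂ) :
    bCZ n N ((N : ℤ) - (m : ℤ)) l = BB N (2 * l + (n : ℂ) - 2 * (N : ℂ) - 1) m := by
  have h : ((N : ℤ) - (m : ℤ)).toNat = N - m := by omega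
  rw [bCZ, if_pos (by omega), h, bC, BB, show N - (N - m) = m by omega,
    show 2 * N - 2 * (N - m) + 1 = 2 * m + 1 by omega]
  congr 1
  rw [Finset.prod_Ico_eq_prod_range, show N - (N - m) = m by omega, ← Finset.prod_range_reflect, ff]
  apply Finset.prod_congr rfl
  intro t ht
  have ht' : t < m := by simpa using ht
  rw [show N - m + (m - 1 - t) = N - 1 - t by omega, Nat.sub_sub,
    Nat.cast_sub (by omega : 1 + t ≤ N)]
  push_cast
  ring

lemma bCZ_neg (n N m : ℕ) (hm : N < m) (l : ℂ) :
    bCZ n N ((N : ℤ) - (m : ℤ)) l = 0 := by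
  rw [bCZ, if_neg (by omega)]

lemma choose_id (k i : ℕ) :
    (k : ℂ) * (k.choose i : ℂ) = (i + 1) * (k.choose (i + 1) : ℂ) + i * (k.choose i : ℂ) := by
  rcases le_or_gt i k with h | h
  · have := Nat.choose_succ_right_eq k i
    have h2 : ((k.choose (i + 1) : ℕ) : ℂ) * (i + 1) = (k.choose i : ℂ) * (k - i) := by
      rw [← Nat.cast_sub h]; exact_mod_cast this
    linear_combination -h2
  · rw [Nat.choose_eq_zero_of_lt h, Nat.choose_eq_zero_of_lt (by omega)]
    simp

lemma shift_sum (n N : ℕ) (l p : ℂ) (i : ℕ) :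
    ∑ j ∈ Finset.Icc (-1 : ℤ) ((N : ℤ) - ((i + 1 : ℕ) : ℤ)),
        (-1 : ℂ) ^ ((N : ℤ) - j - ((i + 1 : ℕ) : ℤ) - 1) *
          ((((N : ℤ) - j).toNat.choose (i + 1) : ℂ)) *
          ((l + p - 2 * (N : ℂ) + 1 + 2 * (j : ℂ)) * bCZ n N (j + 1) l -
            (2 * (N : ℂ) - 2 * (j : ℂ) + 1) * bCZ n N j l) =
    ∑ k ∈ Finset.range (N + 1), (-1 : ℂ) ^ (k + i + 1) * ((k + 1).choose (i + 1) : ℂ) *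
      ((l + p - 1 - 2 * (k : ℂ)) * bCZ n N ((N : ℤ) - (k : ℤ)) l -
        (2 * (k : ℂ) + 3) * bCZ n N ((N : ℤ) - ((k + 1 : ℕ) : ℤ)) l) := by
  symm
  rw [← Finset.sum_subset (s₁ := Finset.Ico i (N + 1))]
  · refine Finset.sum_bij' (fun k _ => (N : ℤ) - 1 - k) (fun j _ => ((N : ℤ) - 1 - j).toNat)
      ?_ ?_ ?_ ?_ ?_
    · intro k hk; simp at hk ⊢; omega
    · intro k hk; simp at hk ⊢; omega
    · intro k hk; simp
    · intro k hk; simp at hk ⊢; omega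
    · intro k hk
      simp at hk
      have e1 : ((N : ℤ) - ((N : ℤ) - 1 - k)).toNat = k + 1 := by omega
      have e2 : (N : ℤ) - ((N : ℤ) - 1 - k) - ((i + 1 : ℕ) : ℤ) - 1 = ((k - i : ℕ) : ℤ) - 1 := by
        omega
      have e3 : (N : ℤ) - 1 - k + 1 = N - k := by ring
      have e4 : (N : ℤ) - 1 - k = (N : ℤ) - ((k + 1 : ℕ) : ℤ) := by push_cast; ring
      have e5 : (-1 : ℂ) ^ (((k - i : ℕ) : ℤ) - 1) = (-1) ^ (k + i + 1) := by
        rw [zpow_sub₀ (by norm_num), zpow_natCast]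
        obtain ⟨d, rfl⟩ := Nat.exists_eq_add_of_le hk.1
        rw [Nat.add_sub_cancel_left, show i + d + i + 1 = d + 1 + 2 * i by ring, pow_add _ _ (2 * i),
          pow_mul, pow_succ]
        simp [div_neg]
      rw [e1, e2, e3, e5]
      rw [e4]
      push_cast
      ring
  · intro k; simp
  · intro k hk hk'
    simp at hk hk'
    rw [Nat.choose_eq_zero_of_lt (by omega)]
    simp

lemma Icc_prod_ff (n N i : ℕ) (l : ℂ) :
    ∏ k ∈ Finset.Icc (i + 1) N, (2 * l + (n : ℂ) - 2 * (k : ℂ)) =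
      ff (2 * l + (n : ℂ) - 2 - 2 * (i : ℂ)) (N - i) := by
  rw [← Finset.Ico_add_one_right_eq_Icc, Finset.prod_Ico_eq_prod_range, ff,
    show N + 1 - (i + 1) = N - i by omega]
  apply Finset.prod_congr rfl
  intro t _
  push_cast
  ring

lemma gamma_eq (n N i : ℕ) (hi : i + 1 ≤ N) (l p : ℂ) :
    gammaC n N (i + 1) l p = (-1) ^ (i + 1) *
      ((l + p - 2 * (i + 1)) *
        (2 ^ N * ((N.factorial : ℂ) / ((2 * N + 1).factorial : ℂ)) * (N.choose (i + 1) : ℂ) *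
          ff (2 * l + (n : ℂ) - 2 - 2 * ((i + 1 : ℕ) : ℂ)) (N - (i + 1)) *
          ff (2 * l + (n : ℂ) - 2 * (N : ℂ) - 1 - 2) (i + 1)) +
      (l + p + 1 - 2 * (i + 1)) *
        (2 ^ N * ((N.factorial : ℂ) / ((2 * N + 1).factorial : ℂ)) * (N.choose i : ℂ) *
          ff (2 * l + (n : ℂ) - 2 - 2 * (i : ℂ)) (N - i) *
          ff (2 * l + (n : ℂ) - 2 * (N : ℂ) - 1 - 2) i)) := by
  have hQ : ∏ k ∈ Finset.Icc 1 i, (2 * l + (n : ℂ) - 2 * (k : ℂ) - 2 * (N : ℂ) - 1) =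
      ff (2 * l + (n : ℂ) - 2 * (N : ℂ) - 1 - 2) i := by
    rw [← Finset.Ico_add_one_right_eq_Icc, Finset.prod_Ico_eq_prod_range, ff,
      Nat.add_sub_cancel]
    apply Finset.prod_congr rfl
    intro t _
    push_cast
    ring
  have n0 : (N : ℂ) + 1 ≠ 0 := by exact_mod_cast Nat.succ_ne_zero N
  have c1 : (N.choose i : ℂ) = (i + 1) * ((N + 1).choose (i + 1) : ℂ) / (N + 1) := by
    rw [eq_div_iff n0]
    have := Nat.add_one_mul_choose_eq N i
    have h : ((N : ℂ) + 1) * (N.choose i : ℂ) = ((N + 1).choose (i + 1) : ℂ) * (i + 1) := by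
      exact_mod_cast this
    linear_combination h
  have c2 : (N.choose (i + 1) : ℂ) = (N - i) * ((N + 1).choose (i + 1) : ℂ) / (N + 1) := by
    have h : ((N + 1).choose (i + 1) : ℂ) = N.choose i + N.choose (i + 1) := by
      exact_mod_cast Nat.choose_succ_succ N i
    have h2 : (N.choose (i + 1) : ℂ) = ((N + 1).choose (i + 1) : ℂ) - N.choose i := by
      rw [h]; ring
    rw [h2, c1]
    field_simp
    ring
  have hN : N - i = (N - (i + 1)) + 1 := by omega
  rw [gammaC, Icc_prod_ff, Nat.add_sub_cancel, hQ, hN, ff_succ' (2 * l + (n : ℂ) - 2 - 2 * (i : ℂ)), ff_succ, c1, c2,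
    show 2 * l + (n : ℂ) - 2 - 2 * (i : ℂ) - 2 = 2 * l + (n : ℂ) - 2 - 2 * ((i + 1 : ℕ) : ℂ) by
      push_cast; ring]
  have n1 : ((2 * N + 1).factorial : ℂ) ≠ 0 := by exact_mod_cast Nat.factorial_ne_zero _
  generalize ff (2 * l + (n : ℂ) - 2 - 2 * ((i + 1 : ℕ) : ℂ)) (N - (i + 1)) = P
  generalize ff (2 * l + (n : ℂ) - 2 * (N : ℂ) - 1 - 2) i = Q
  generalize ((2 * N + 1).factorial : ℂ) = A at *
  generalize (N.factorial : ℂ) = A' at *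
  generalize ((N + 1).choose (i + 1) : ℂ) = C at *
  push_cast
  field_simp
  ring

theorem gamma_summation_formula (n : ℕ) (hn : 2 ≤ n) (N : ℕ) (hN : 1 ≤ N) (l p : ℂ)
    (i : ℕ) (hi1 : 1 ≤ i) (hiN : i ≤ N) :
    ∑ j ∈ Finset.Icc (-1 : ℤ) ((N : ℤ) - (i : ℤ)),
        (-1 : ℂ) ^ ((N : ℤ) - j - (i : ℤ) - 1) * ((((N : ℤ) - j).toNat.choose i : ℂ)) *
          ((l + p - 2 * (N : ℂ) + 1 + 2 * (j : ℂ)) * bCZ n N (j + 1) l -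
            (2 * (N : ℂ) - 2 * (j : ℂ) + 1) * bCZ n N j l)
      = gammaC n N i l p := by
  obtain ⟨i, rfl⟩ : ∃ k, i = k + 1 := ⟨i - 1, by omega⟩
  rw [shift_sum, gamma_eq n N i hiN]
  have s1 := BB_sum N (2 * l + (n : ℂ) - 2 * (N : ℂ) - 1) (i + 1) hiN
  have s0 := BB_sum N (2 * l + (n : ℂ) - 2 * (N : ℂ) - 1) i (by omega)
  rw [show 2 * l + (n : ℂ) - 2 * (N : ℂ) - 1 + 2 * (N : ℂ) - 1 = 2 * l + (n : ℂ) - 2 by ring]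
    at s0 s1
  rw [← s0, ← s1]
  let g : ℕ → ℂ := fun k => (-1 : ℂ) ^ (k + i) * (k.choose (i + 1) : ℂ) * (2 * (k : ℂ) + 1) *
    bCZ n N ((N : ℤ) - (k : ℤ)) l
  have hg : ∑ k ∈ Finset.range (N + 1), g (k + 1) = ∑ k ∈ Finset.range (N + 1), g k := by
    have h1 := Finset.sum_range_succ g (N + 1)
    have h2 := Finset.sum_range_succ' g (N + 1)
    have h3 : g (N + 1) = 0 := by
      simp only [g]; rw [bCZ_neg n N (N + 1) (by omega)]; simp
    have h4 : g 0 = 0 := by simp [g]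
    rw [h3] at h1; rw [h4] at h2
    linear_combination h1 - h2
  trans ∑ k ∈ Finset.range (N + 1), ((-1 : ℂ) ^ (k + i + 1) * ((k + 1).choose (i + 1) : ℂ) *
      ((l + p - 1 - 2 * (k : ℂ)) * bCZ n N ((N : ℤ) - (k : ℤ)) l) - g k)
  · rw [Finset.sum_sub_distrib, ← hg, ← Finset.sum_sub_distrib]
    apply Finset.sum_congr rfl
    intro k _
    simp only [g]
    push_cast
    ring
  · rw [Finset.mul_sum, Finset.mul_sum, ← Finset.sum_add_distrib, Finset.mul_sum]
    apply Finset.sum_congr rfl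
    intro k hk
    have hk' : k ≤ N := by simpa [Nat.lt_succ_iff] using hk
    simp only [g]
    rw [bCZ_eq n N k hk', Nat.choose_succ_succ]
    have q0 := choose_id k i
    push_cast
    simp only [pow_succ, pow_add]
    generalize BB N (2 * l + (n : ℂ) - 2 * (N : ℂ) - 1) k = B
    linear_combination (2 * (-1 : ℂ) ^ k * (-1) ^ i * B) * q0
end
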